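/- There exists a sequence of 4-uniform 2-hypertrees whose edge number is asymptotically (2/7)·C(n, 3) as the number of vertices n tends to infinity. -/

import Mathlib

variable {V : Type*} [DecidableEq V]

/-- The list of consecutive `k`-windows (as finsets) of a vertex sequence. -/
def windows (k : ℕ) (w : List V) : List (Finset V) :=
  (List.range (w.length + 1 - k)).map fun i => ((w.drop i).take k).toFinset

/-- `w` is the vertex sequence of a chain: `v₁ ≠ v_l`, each window is a `k`-set,
and the `l - k + 1` window edges are pairwise distinct. -/
def IsChainSeq (k : ℕ) (w : List V) : Prop :=
  k ≤ w.length ∧ w.head? ≠ w.getLast? ∧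
  (∀ e ∈ windows k w, e.card = k) ∧ (windows k w).Nodup

/-- `w` is the vertex sequence of a semicycle: `v₁ = v_l`, each window is a `k`-set,
and the `l - k + 1` window edges are pairwise distinct. -/
def IsSemicycleSeq (k : ℕ) (w : List V) : Prop :=
  k ≤ w.length ∧ w.head? = w.getLast? ∧
  (∀ e ∈ windows k w, e.card = k) ∧ (windows k w).Nodup

/-- A hypergraph with edge set `E` contains no semicycle as a subhypergraph. -/
def SemicycleFree (k : ℕ) (E : Finset (Finset V)) : Prop :=
  ¬ ∃ w : List V, IsSemicycleSeq k w ∧ ∀ e ∈ windows k w, e ∈ E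

/-- Every two distinct vertices of `S` lie in a common chain subhypergraph of `E`. -/
def ChainConnOn (k : ℕ) (S : Finset V) (E : Finset (Finset V)) : Prop :=
  ∀ u ∈ S, ∀ v ∈ S, u ≠ v →
    ∃ w : List V, IsChainSeq k w ∧ (∀ e ∈ windows k w, e ∈ E) ∧ u ∈ w ∧ v ∈ w

/-- Chain-connectedness on the whole (finite) vertex type. -/
def ChainConn [Fintype V] (k : ℕ) (E : Finset (Finset V)) : Prop :=
  ChainConnOn k Finset.univ E

/-- A `k`-uniform hypertree: chain-connected and semicycle-free. -/
def IsHypertree [Fintype V] (k : ℕ) (E : Finset (Finset V)) : Prop :=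
  (∀ e ∈ E, e.card = k) ∧ ChainConn k E ∧ SemicycleFree k E

/-- Every chain subhypergraph of `E` has length (number of edges) at most `l`. -/
def ChainsLenLE (k l : ℕ) (E : Finset (Finset V)) : Prop :=
  ∀ w : List V, IsChainSeq k w → (∀ e ∈ windows k w, e ∈ E) →
    w.length + 1 - k ≤ l

/-- An `l`-hypertree: a hypertree all of whose chains have length at most `l`. -/
def IsLHypertree [Fintype V] (k l : ℕ) (E : Finset (Finset V)) : Prop :=
  IsHypertree k E ∧ ChainsLenLE k l E

/-- Edge-minimal: deleting any edge destroys chain-connectedness. -/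
def EdgeMinimal [Fintype V] (k : ℕ) (E : Finset (Finset V)) : Prop :=
  ∀ e ∈ E, ¬ ChainConn k (E.erase e)

/-- Edge-maximal: adding any new `k`-set as an edge creates a semicycle. -/
def EdgeMaximal [Fintype V] (k : ℕ) (E : Finset (Finset V)) : Prop :=
  ∀ s : Finset V, s.card = k → s ∉ E → ¬ SemicycleFree k (insert s E)

/-- `S` is a (tight) star subhypergraph of `E`: a nonempty set of edges of `E`
all containing a common `(k-1)`-set kernel. -/
def IsStarSub (k : ℕ) (E S : Finset (Finset V)) : Prop :=
  S ⊆ E ∧ S.Nonempty ∧ ∃ K : Finset V, K.card = k - 1 ∧ ∀ e ∈ S, K ⊆ e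

/-- `S` is a maximal star subhypergraph of `E`. -/
def IsMaxStar (k : ℕ) (E S : Finset (Finset V)) : Prop :=
  IsStarSub k E S ∧ ∀ T, IsStarSub k E T → S ⊆ T → S = T

theorem windows_four_cons (a b c d : V) (l : List V) :
    windows 4 (a :: b :: c :: d :: l) =
      ({a, b, c, d} : Finset V) :: windows 4 (b :: c :: d :: l) := by
  have h1 : (a :: b :: c :: d :: l).length + 1 - 4 = l.length + 1 := by simp
  have h2 : (b :: c :: d :: l).length + 1 - 4 = l.length := by simp
  unfold windows
  rw [h1, h2, List.range_succ_eq_map]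
  simp [Function.comp_def]

theorem windows_four_triple (a b c : V) : windows 4 [a, b, c] = [] := by
  simp [windows]

/-- If every edge of `E` has a triple below it such that two distinct edges share three vertices
only when their triples agree, then three consecutive windows cannot all be edges. -/
theorem not_three_windows {E : Finset (Finset V)} {K : Finset V → Finset V}
    (hK : ∀ e ∈ E, (K e).card = 3)
    (hE : ∀ e ∈ E, ∀ f ∈ E, e ≠ f → 3 ≤ (e ∩ f).card → e ∩ f = K e)
    {a b c d f g : V} (h1 : ({a, b, c, d} : Finset V) ∈ E) (h2 : ({b, c, d, f} : Finset V) ∈ E)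
    (h3 : ({c, d, f, g} : Finset V) ∈ E) (c2 : ({b, c, d, f} : Finset V).card = 4)
    (h12 : ({a, b, c, d} : Finset V) ≠ {b, c, d, f})
    (h23 : ({b, c, d, f} : Finset V) ≠ {c, d, f, g}) : False := by
  have hb : ({b, c, d} : Finset V).card = 3 := by
    refine le_antisymm Finset.card_le_three ?_
    have : ({b, c, d, f} : Finset V) = insert f {b, c, d} := by ext; simp; tauto
    rw [this] at c2
    have := Finset.card_insert_le f ({b, c, d} : Finset V)
    omega
  have hc : ({c, d, f} : Finset V).card = 3 := by
    refine le_antisymm Finset.card_le_three ?_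
    have := Finset.card_insert_le b ({c, d, f} : Finset V)
    omega
  have s1 : ({b, c, d} : Finset V) ⊆ {b, c, d, f} ∩ {a, b, c, d} := by
    intro x; simp; tauto
  have s2 : ({c, d, f} : Finset V) ⊆ {b, c, d, f} ∩ {c, d, f, g} := by
    intro x; simp; tauto
  have e1 := hE _ h2 _ h1 h12.symm (hb ▸ Finset.card_le_card s1)
  have e2 := hE _ h2 _ h3 h23 (hc ▸ Finset.card_le_card s2)
  have hs : ({b, c, d, f} : Finset V) ⊆ K {b, c, d, f} := by
    intro x hx
    have : x ∈ ({b, c, d} : Finset V) ∨ x ∈ ({c, d, f} : Finset V) := by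
      simp at hx ⊢; tauto
    rcases this with h | h
    · exact e1 ▸ s1 h
    · exact e2 ▸ s2 h
  have := Finset.card_le_card hs
  rw [c2, hK _ h2] at this
  omega

theorem windows_length_le_two {E : Finset (Finset V)} {K : Finset V → Finset V}
    (hK : ∀ e ∈ E, (K e).card = 3)
    (hE : ∀ e ∈ E, ∀ f ∈ E, e ≠ f → 3 ≤ (e ∩ f).card → e ∩ f = K e)
    {w : List V} (hc : ∀ e ∈ windows 4 w, e.card = 4) (hn : (windows 4 w).Nodup)
    (hw : ∀ e ∈ windows 4 w, e ∈ E) : w.length ≤ 5 := by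
  rcases w with _ | ⟨a, _ | ⟨b, _ | ⟨c, _ | ⟨d, _ | ⟨f, _ | ⟨g, l⟩⟩⟩⟩⟩⟩ <;>
    try (simp; done)
  exfalso
  simp only [windows_four_cons] at hc hn hw
  refine not_three_windows hK hE (hw {a, b, c, d} (by simp)) (hw {b, c, d, f} (by simp))
    (hw {c, d, f, g} (by simp)) (hc {b, c, d, f} (by simp)) ?_ ?_
  · intro h; simp [h] at hn
  · intro h; simp [h] at hn

theorem chainsLenLE_two_of_kernel {E : Finset (Finset V)} {K : Finset V → Finset V}
    (hK : ∀ e ∈ E, (K e).card = 3)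
    (hE : ∀ e ∈ E, ∀ f ∈ E, e ≠ f → 3 ≤ (e ∩ f).card → e ∩ f = K e) : ChainsLenLE 4 2 E := by
  rintro w ⟨-, -, hc, hn⟩ hw
  have := windows_length_le_two hK hE hc hn hw
  omega

theorem semicycleFree_of_kernel {E : Finset (Finset V)} {K : Finset V → Finset V}
    (hK : ∀ e ∈ E, (K e).card = 3)
    (hE : ∀ e ∈ E, ∀ f ∈ E, e ≠ f → 3 ≤ (e ∩ f).card → e ∩ f = K e) : SemicycleFree 4 E := by
  rintro ⟨w, ⟨hl, he, hc, hn⟩, hw⟩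
  have hle := windows_length_le_two hK hE hc hn hw
  rcases w with _ | ⟨a, _ | ⟨b, _ | ⟨c, _ | ⟨d, _ | ⟨f, _ | ⟨g, l⟩⟩⟩⟩⟩⟩ <;> try (simp at hl; done)
  · simp only [List.head?_cons, List.getLast?_cons_cons, List.getLast?_singleton,
      Option.some.injEq] at he
    subst he
    have h := hc {a, b, c, a} (by simp [windows_four_cons])
    have : ({a, b, c, a} : Finset V) = {a, b, c} := by ext; simp; tauto
    rw [this] at h
    have := Finset.card_le_three (a := a) (b := b) (c := c)
    omega
  · simp only [List.head?_cons, List.getLast?_cons_cons, List.getLast?_singleton,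
      Option.some.injEq] at he
    subst he
    have : ({b, c, d, a} : Finset V) = {a, b, c, d} := by ext; simp; tauto
    simp [windows_four_cons, windows_four_triple, this] at hn
  · simp at hle; omega

theorem xor_lt_two_pow_of_le {j y z : ℕ} (hy : 2 ^ j ≤ y) (hz : 2 ^ j ≤ z)
    (hy' : y < 2 ^ (j + 1)) (hz' : z < 2 ^ (j + 1)) : y ^^^ z < 2 ^ j := by
  have hp : 0 < 2 ^ j := by positivity
  have h1 : y / 2 ^ j = 1 := Nat.div_eq_of_lt_le (by omega) (by rw [pow_succ] at hy'; omega)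
  have h2 : z / 2 ^ j = 1 := Nat.div_eq_of_lt_le (by omega) (by rw [pow_succ] at hz'; omega)
  have h3 : (y ^^^ z) / 2 ^ j = 0 := by rw [Nat.xor_div_two_pow, h1, h2]; simp
  rcases Nat.div_eq_zero_iff.1 h3 with h | h <;> omega

theorem le_xor_of_lt {j y z : ℕ} (hy : y < 2 ^ j) (hz : 2 ^ j ≤ z) : 2 ^ j ≤ y ^^^ z := by
  by_contra! h
  have := Nat.xor_lt_two_pow hy h
  rw [← Nat.xor_assoc, Nat.xor_self, Nat.zero_xor] at this
  omega

theorem xor_eq_iff {a b c : ℕ} : a ^^^ b = c ↔ b = a ^^^ c := by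
  constructor <;> rintro rfl <;> rw [← Nat.xor_assoc, Nat.xor_self, Nat.zero_xor]

theorem card_filter_xor_lt {j k : ℕ} (hk : k < 2 ^ j) :
    ((Finset.range (2 ^ j + k)).filter fun y => y ^^^ (2 ^ j + k) < y).card = k := by
  have : (Finset.range (2 ^ j + k)).filter (fun y => y ^^^ (2 ^ j + k) < y) =
      Finset.Ico (2 ^ j) (2 ^ j + k) := by
    ext y
    simp only [Finset.mem_filter, Finset.mem_range, Finset.mem_Ico]
    constructor
    · rintro ⟨h1, h2⟩
      refine ⟨?_, h1⟩
      by_contra! h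
      have := le_xor_of_lt h (Nat.le_add_right (2 ^ j) k)
      omega
    · rintro ⟨h1, h2⟩
      refine ⟨h2, lt_of_lt_of_le (xor_lt_two_pow_of_le h1 (by omega) ?_ ?_) h1⟩ <;>
        rw [pow_succ] <;> omega
  simp [this]

theorem sum_range_mul_sub (k : ℕ) (c : ℤ) :
    6 * ∑ i ∈ Finset.range k, (i : ℤ) * (c - i) = k * (k - 1) * (3 * c - 2 * k + 1) := by
  induction k with
  | zero => simp
  | succ k ih => rw [Finset.sum_range_succ, mul_add, ih]; push_cast; ring

theorem sum_card_filter_xor_lt (m : ℕ) (M : ℤ) :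
    42 * ∑ z ∈ Finset.range (2 ^ m),
      (((Finset.range z).filter fun y => y ^^^ z < y).card : ℤ) * (M - 1 - z) =
      -5 * ((2 ^ m) ^ 3 - 1) + 7 * (M + 1) * ((2 ^ m) ^ 2 - 1) - 7 * (3 * M - 2) * (2 ^ m - 1) := by
  induction m with
  | zero => simp
  | succ m ih =>
    have hs : ∑ k ∈ Finset.range (2 ^ m),
        (((Finset.range (2 ^ m + k)).filter fun y => y ^^^ (2 ^ m + k) < y).card : ℤ) *
          (M - 1 - (2 ^ m + k : ℕ)) =
        ∑ k ∈ Finset.range (2 ^ m), (k : ℤ) * ((M - 1 - 2 ^ m) - k) := by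
      refine Finset.sum_congr rfl fun k hk => ?_
      rw [card_filter_xor_lt (Finset.mem_range.1 hk)]
      push_cast
      ring
    have h6 := sum_range_mul_sub (2 ^ m) (M - 1 - 2 ^ m)
    rw [pow_succ 2 m, mul_two, Finset.sum_range_add, mul_add, ih, hs, pow_succ (2 : ℤ) m]
    push_cast at h6
    linear_combination 7 * h6

/-- The triples `x < y < z` of the projective Steiner triple system, followed by a larger vertex;
the vertex `i` stands for the nonzero binary vector `i + 1`. -/
def extendedTriples (n : ℕ) : Finset (Fin n × Fin n × Fin n × Fin n) :=
  Finset.univ.filter fun q => q.1 < q.2.1 ∧ q.2.1 < q.2.2.1 ∧ q.2.2.1 < q.2.2.2 ∧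
    (q.2.1.val + 1) ^^^ (q.2.2.1.val + 1) = q.1.val + 1

/-- The ordered extension of the projective Steiner triple system. -/
def orderedExtension (n : ℕ) : Finset (Finset (Fin n)) :=
  (extendedTriples n).image fun q => {q.1, q.2.1, q.2.2.1, q.2.2.2}

theorem mem_orderedExtension {n : ℕ} {e : Finset (Fin n)} :
    e ∈ orderedExtension n ↔ ∃ x y z w : Fin n, x < y ∧ y < z ∧ z < w ∧
      (y.val + 1) ^^^ (z.val + 1) = x.val + 1 ∧ {x, y, z, w} = e := by
  simp [orderedExtension, extendedTriples, and_assoc]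

theorem card_eq_four_of_mem_orderedExtension {n : ℕ} {e : Finset (Fin n)}
    (he : e ∈ orderedExtension n) : e.card = 4 := by
  obtain ⟨x, y, z, w, h1, h2, h3, -, rfl⟩ := mem_orderedExtension.1 he
  exact Finset.card_eq_four.2
    ⟨x, y, z, w, by omega, by omega, by omega, by omega, by omega, by omega, rfl⟩

theorem card_orderedExtension_eq (n : ℕ) :
    (orderedExtension n).card = (extendedTriples n).card := by
  refine Finset.card_image_of_injOn ?_
  rintro ⟨x, y, z, w⟩ h ⟨x', y', z', w'⟩ h' heq
  simp only [extendedTriples, Finset.coe_filter, Finset.mem_univ, true_and, Set.mem_ofPred_eq]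
    at h h' heq
  obtain ⟨h1, h2, h3, -⟩ := h
  obtain ⟨h1', h2', h3', -⟩ := h'
  have a := fun t => congrArg (t ∈ ·) heq
  simp only [Finset.mem_insert, Finset.mem_singleton, eq_iff_iff] at a
  have ax := (a x).1 (by simp)
  have ay := (a y).1 (by simp)
  have az := (a z).1 (by simp)
  have aw := (a w).1 (by simp)
  have bx := (a x').2 (by simp)
  have b_y := (a y').2 (by simp)
  have bz := (a z').2 (by simp)
  have bw := (a w').2 (by simp)
  clear a heq
  have e1 : x = x' := by omega
  subst e1
  have e2 : w = w' := by omega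
  subst e2
  have e3 : y = y' := by omega
  subst e3
  have e4 : z = z' := by omega
  subst e4
  rfl

theorem card_extendedTriples (m : ℕ) :
    (extendedTriples (2 ^ m - 1)).card = ∑ z ∈ Finset.range (2 ^ m),
      ((Finset.range z).filter fun y => y ^^^ z < y).card * (2 ^ m - 1 - z) := by
  have : ∑ z ∈ Finset.range (2 ^ m),
      ((Finset.range z).filter fun y => y ^^^ z < y).card * (2 ^ m - 1 - z) =
      ((Finset.range (2 ^ m)).sigma fun z =>
        ((Finset.range z).filter fun y => y ^^^ z < y) ×ˢ Finset.Ioo z (2 ^ m)).card := by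
    simp only [Finset.card_sigma, Finset.card_product, Nat.card_Ioo]
    refine Finset.sum_congr rfl fun z _ => ?_
    rw [Nat.sub_right_comm]
  rw [this]
  refine Finset.card_nbij
    (fun q => (⟨q.2.2.1.val + 1, (q.2.1.val + 1, q.2.2.2.val + 1)⟩ : (_ : ℕ) × ℕ × ℕ)) ?_ ?_ ?_
  · rintro ⟨x, y, z, w⟩ h
    simp only [extendedTriples, Finset.coe_filter, Finset.mem_univ, true_and, Set.mem_ofPred_eq]
      at h
    obtain ⟨h1, h2, h3, h4⟩ := h
    simp only [Finset.coe_sigma, Set.mem_sigma_iff, Finset.mem_coe, Finset.mem_product,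
      Finset.mem_filter, Finset.mem_range, Finset.mem_Ioo, h4]
    omega
  · rintro ⟨x, y, z, w⟩ h ⟨x', y', z', w'⟩ h' heq
    simp only [extendedTriples, Finset.coe_filter, Finset.mem_univ, true_and, Set.mem_ofPred_eq]
      at h h'
    simp only [Sigma.mk.injEq, Prod.mk.injEq, heq_eq_eq, add_left_inj, Fin.val_inj] at heq
    obtain ⟨rfl, rfl, rfl⟩ := heq
    have : x = x' := by
      have := h.2.2.2.symm.trans h'.2.2.2
      omega
    subst this
    rfl
  · rintro ⟨z, y, w⟩ h
    simp only [Finset.coe_sigma, Set.mem_sigma_iff, Finset.mem_coe, Finset.mem_product,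
      Finset.mem_filter, Finset.mem_range, Finset.mem_Ioo] at h
    obtain ⟨h1, ⟨h2, h3⟩, h4, h5⟩ := h
    have h0 : y ^^^ z ≠ 0 := by rw [Ne, Nat.xor_eq_zero_iff]; omega
    refine ⟨(⟨(y ^^^ z) - 1, by omega⟩, ⟨y - 1, by omega⟩, ⟨z - 1, by omega⟩,
      ⟨w - 1, by omega⟩), ?_, ?_⟩
    · have hy : y - 1 + 1 = y := by omega
      have hz : z - 1 + 1 = z := by omega
      simp only [extendedTriples, Finset.coe_filter, Finset.mem_univ, true_and, Set.mem_ofPred_eq,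
        Fin.mk_lt_mk, hy, hz]
      omega
    · simp only [Sigma.mk.injEq, Prod.mk.injEq, heq_eq_eq]
      omega

theorem card_orderedExtension (m : ℕ) :
    (21 : ℝ) * (orderedExtension (2 ^ m - 1)).card = (2 ^ m - 1) * (2 ^ m - 2) * (2 ^ m - 4) := by
  have h := sum_card_filter_xor_lt m (2 ^ m)
  have hc : ((orderedExtension (2 ^ m - 1)).card : ℤ) = ∑ z ∈ Finset.range (2 ^ m),
      (((Finset.range z).filter fun y => y ^^^ z < y).card : ℤ) * (2 ^ m - 1 - z) := by
    rw [card_orderedExtension_eq, card_extendedTriples]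
    push_cast
    refine Finset.sum_congr rfl fun z hz => ?_
    have : z < 2 ^ m := Finset.mem_range.1 hz
    rw [Nat.sub_sub, Nat.cast_sub (by omega)]
    push_cast
    ring
  rw [← hc] at h
  have : (21 : ℤ) * (orderedExtension (2 ^ m - 1)).card =
      (2 ^ m - 1) * (2 ^ m - 2) * (2 ^ m - 4) := by
    refine mul_left_cancel₀ (two_ne_zero (α := ℤ)) ?_
    linear_combination h
  exact_mod_cast this

theorem mem_orderedExtension_of_xor {n : ℕ} {a b c w : Fin n} (ha : a < w) (hb : b < w)
    (hc : c < w) (hab : a ≠ b) (h : (a.val + 1) ^^^ (b.val + 1) = c.val + 1) :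
    ({a, b, c, w} : Finset (Fin n)) ∈ orderedExtension n := by
  have h2 : (b.val + 1) ^^^ (c.val + 1) = a.val + 1 := by
    rw [← h, Nat.xor_comm, Nat.xor_assoc, Nat.xor_self, Nat.xor_zero]
  have h3 : (c.val + 1) ^^^ (a.val + 1) = b.val + 1 := by
    rw [← h, Nat.xor_comm, ← Nat.xor_assoc, Nat.xor_self, Nat.zero_xor]
  have hbc : b ≠ c := by
    rintro rfl; simp at h2
  have hca : c ≠ a := by
    rintro rfl; simp at h3
  have h' := (Nat.xor_comm _ _).trans h
  have h2' := (Nat.xor_comm _ _).trans h2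
  have h3' := (Nat.xor_comm _ _).trans h3
  rw [mem_orderedExtension]
  rcases lt_or_gt_of_ne hab with h5 | h5 <;> rcases lt_or_gt_of_ne hbc with h6 | h6 <;>
    rcases lt_or_gt_of_ne hca with h7 | h7 <;> try (exfalso; omega)
  · exact ⟨a, b, c, w, h5, h6, hc, h2, rfl⟩
  · exact ⟨c, a, b, w, h7, h5, hb, h, by ext; simp; tauto⟩
  · exact ⟨a, c, b, w, h7, h6, hb, h2', by ext; simp; tauto⟩
  · exact ⟨b, c, a, w, h6, h7, ha, h3, by ext; simp; tauto⟩
  · exact ⟨b, a, c, w, h5, h7, hc, h3', by ext; simp; tauto⟩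
  · exact ⟨c, b, a, w, h6, h5, ha, h', by ext; simp; tauto⟩

theorem card_inter_le_one_of_xor {n : ℕ} {x y z x' y' z' : Fin n}
    (h : (y.val + 1) ^^^ (z.val + 1) = x.val + 1)
    (h' : (y'.val + 1) ^^^ (z'.val + 1) = x'.val + 1)
    (hne : ({x, y, z} : Finset (Fin n)) ≠ {x', y', z'}) :
    (({x, y, z} : Finset (Fin n)) ∩ {x', y', z'}).card ≤ 1 := by
  have key : ∀ {x y z : Fin n}, (y.val + 1) ^^^ (z.val + 1) = x.val + 1 →
      ∀ p ∈ ({x, y, z} : Finset (Fin n)), ∀ q ∈ ({x, y, z} : Finset (Fin n)), p ≠ q →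
      ∀ r, r ∈ ({x, y, z} : Finset (Fin n)) ↔
        r = p ∨ r = q ∨ (p.val + 1) ^^^ (q.val + 1) = r.val + 1 := by
    intro x y z h p hp q hq hpq r
    have h2 : (z.val + 1) ^^^ (x.val + 1) = y.val + 1 := by
      rw [← h, Nat.xor_comm, Nat.xor_assoc, Nat.xor_self, Nat.xor_zero]
    have h3 : (x.val + 1) ^^^ (y.val + 1) = z.val + 1 := by
      rw [← h, Nat.xor_comm, ← Nat.xor_assoc, Nat.xor_self, Nat.zero_xor]
    have h1' := (Nat.xor_comm _ _).trans h
    have h2' := (Nat.xor_comm _ _).trans h2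
    have h3' := (Nat.xor_comm _ _).trans h3
    simp only [Finset.mem_insert, Finset.mem_singleton] at hp hq ⊢
    rcases hp with rfl | rfl | rfl <;> rcases hq with rfl | rfl | rfl <;>
      first
      | exact absurd rfl hpq
      | (simp only [h, h2, h3, h1', h2', h3', add_left_inj, Fin.val_inj]
         grind)
  rw [Finset.card_le_one]
  intro p hp q hq
  by_contra hpq
  rw [Finset.mem_inter] at hp hq
  apply hne
  ext r
  rw [key h p hp.1 q hq.1 hpq, key h' p hp.2 q hq.2 hpq]

/-- An edge of the ordered extension without its largest vertex. -/
def lowerTriple {n : ℕ} (e : Finset (Fin n)) : Finset (Fin n) :=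
  e.filter fun a => ∃ b ∈ e, a < b

theorem lowerTriple_eq {n : ℕ} {x y z w : Fin n} (h1 : x < y) (h2 : y < z) (h3 : z < w) :
    lowerTriple {x, y, z, w} = {x, y, z} := by
  ext a
  simp only [lowerTriple, Finset.mem_filter, Finset.mem_insert, Finset.mem_singleton,
    exists_eq_or_imp, exists_eq_left]
  omega

theorem inter_eq_lowerTriple {n : ℕ} {e f : Finset (Fin n)} (he : e ∈ orderedExtension n)
    (hf : f ∈ orderedExtension n) (hne : e ≠ f) (hc : 3 ≤ (e ∩ f).card) :
    e ∩ f = lowerTriple e := by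
  have hec := card_eq_four_of_mem_orderedExtension he
  have hfc := card_eq_four_of_mem_orderedExtension hf
  obtain ⟨x, y, z, w, h1, h2, h3, h4, rfl⟩ := mem_orderedExtension.1 he
  obtain ⟨x', y', z', w', h1', h2', h3', h4', rfl⟩ := mem_orderedExtension.1 hf
  rw [lowerTriple_eq h1 h2 h3]
  have hT : ({x, y, z} : Finset (Fin n)) = {x', y', z'} := by
    by_contra hT
    have hle := card_inter_le_one_of_xor h4 h4' hT
    have : ∃ q, ({x, y, z, w} : Finset (Fin n)) ∩ {x', y', z', w'} ⊆
        insert q (({x, y, z} : Finset (Fin n)) ∩ {x', y', z'}) := by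
      by_cases hw : w ≤ z'
      · refine ⟨w, fun a ha => ?_⟩
        simp only [Finset.mem_inter, Finset.mem_insert, Finset.mem_singleton] at ha ⊢
        omega
      · refine ⟨w', fun a ha => ?_⟩
        simp only [Finset.mem_inter, Finset.mem_insert, Finset.mem_singleton] at ha ⊢
        omega
    obtain ⟨q, hq⟩ := this
    have := (Finset.card_le_card hq).trans (Finset.card_insert_le _ _)
    omega
  symm
  refine Finset.eq_of_subset_of_card_le (fun a ha => ?_) ?_
  · have ha' := hT ▸ ha
    simp only [Finset.mem_inter, Finset.mem_insert, Finset.mem_singleton] at ha ha' ⊢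
    tauto
  · have hlt : ({x, y, z, w} : Finset (Fin n)) ∩ {x', y', z', w'} ⊂ {x, y, z, w} := by
      refine Finset.ssubset_iff_subset_ne.2 ⟨Finset.inter_subset_left, fun h => hne ?_⟩
      exact Finset.eq_of_subset_of_card_le (Finset.inter_eq_left.1 h) (by omega)
    have := Finset.card_lt_card hlt
    have h3c : ({x, y, z} : Finset (Fin n)).card = 3 :=
      Finset.card_eq_three.2 ⟨x, y, z, by omega, by omega, by omega, rfl⟩
    omega

theorem card_lowerTriple {n : ℕ} {e : Finset (Fin n)} (he : e ∈ orderedExtension n) :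
    (lowerTriple e).card = 3 := by
  obtain ⟨x, y, z, w, h1, h2, h3, -, rfl⟩ := mem_orderedExtension.1 he
  rw [lowerTriple_eq h1 h2 h3]
  exact Finset.card_eq_three.2 ⟨x, y, z, by omega, by omega, by omega, rfl⟩

/-- Two vertices of a common edge lie on a chain. -/
theorem chain_of_edge {E : Finset (Finset V)} {e : Finset V} (he : e ∈ E) (hc : e.card = 4)
    {u v : V} (hu : u ∈ e) (hv : v ∈ e) :
    ∃ w : List V, IsChainSeq 4 w ∧ (∀ e ∈ windows 4 w, e ∈ E) ∧ u ∈ w ∧ v ∈ w := by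
  obtain ⟨a, b, c, d, hab, hac, had, hbc, hbd, hcd, rfl⟩ := Finset.card_eq_four.1 hc
  refine ⟨[a, b, c, d], ⟨by simp, by simpa using had, ?_, ?_⟩, ?_, ?_, ?_⟩
  · simpa [windows_four_cons, windows_four_triple] using hc
  · simp [windows_four_cons, windows_four_triple]
  · simpa [windows_four_cons, windows_four_triple] using he
  · simpa using hu
  · simpa using hv

/-- Two distinct nonzero binary vectors of length at least three lie in a Steiner triple extended
by a larger vector. -/
theorem exists_extended_triple (m : ℕ) {u v : ℕ} (hu : 0 < u) (huv : u < v)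
    (hv : v < 2 ^ (m + 3)) :
    ∃ a b w : ℕ, 0 < a ∧ 0 < b ∧ a ≠ b ∧ a < w ∧ b < w ∧ a ^^^ b < w ∧ w < 2 ^ (m + 3) ∧
      (u = a ∧ (v = b ∨ v = w)) := by
  have hp : 0 < 2 ^ m := by positivity
  have e2 : 2 ^ (m + 2) = 4 * 2 ^ m := by ring
  have e3 : 2 ^ (m + 3) = 8 * 2 ^ m := by ring
  by_cases hvN : v = 2 ^ (m + 3) - 1
  · obtain ⟨a, ha0, ha3, hau, haN⟩ :
        ∃ a, 0 < a ∧ a ≤ 3 ∧ u ≠ a ∧ a ≠ u ^^^ (2 ^ (m + 3) - 1) := by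
      by_contra! h
      have := h 1
      have := h 2
      have := h 3
      omega
    have hx : u ^^^ a < 2 ^ (m + 3) := Nat.xor_lt_two_pow (by omega) (by omega)
    have hx' : u ^^^ a ≠ 2 ^ (m + 3) - 1 := fun h => haN (xor_eq_iff.1 h)
    exact ⟨u, a, v, hu, ha0, hau, huv, by omega, by omega, hv, rfl, Or.inr rfl⟩
  have hx : u ^^^ v < 2 ^ (m + 3) := Nat.xor_lt_two_pow (by omega) hv
  by_cases hN : u ^^^ v = 2 ^ (m + 3) - 1
  · have hv2 : 2 ^ (m + 2) ≤ v := by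
      by_contra! h
      have := Nat.xor_lt_two_pow (huv.trans h) h
      omega
    have hu2 : u < 2 ^ (m + 2) := by
      by_contra! h
      have := xor_lt_two_pow_of_le h hv2 (huv.trans hv) hv
      omega
    obtain ⟨a, ha0, ha2, hau⟩ : ∃ a, 0 < a ∧ a ≤ 2 ∧ u ≠ a := by
      by_contra! h
      have := h 1
      have := h 2
      omega
    have := Nat.xor_lt_two_pow hu2 (show a < 2 ^ (m + 2) by omega)
    exact ⟨u, a, v, hu, ha0, hau, huv, by omega, by omega, hv, rfl, Or.inr rfl⟩
  · exact ⟨u, v, 2 ^ (m + 3) - 1, hu, by omega, by omega, by omega, by omega, by omega, by omega,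
      rfl, Or.inl rfl⟩

theorem exists_mem_orderedExtension (m : ℕ) {u v : Fin (2 ^ (m + 3) - 1)} (huv : u < v) :
    ∃ e ∈ orderedExtension (2 ^ (m + 3) - 1), u ∈ e ∧ v ∈ e := by
  obtain ⟨a, b, w, ha, hb, hab, haw, hbw, hcw, hw, hua, hvb⟩ :=
    exists_extended_triple m (u := u.val + 1) (v := v.val + 1) (by omega) (by omega) (by omega)
  have h0 : a ^^^ b ≠ 0 := by rwa [Ne, Nat.xor_eq_zero_iff]
  have ha1 : a - 1 + 1 = a := by omega
  have hb1 : b - 1 + 1 = b := by omega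
  refine ⟨{⟨a - 1, by omega⟩, ⟨b - 1, by omega⟩, ⟨(a ^^^ b) - 1, by omega⟩, ⟨w - 1, by omega⟩},
    mem_orderedExtension_of_xor ?_ ?_ ?_ ?_ ?_, ?_, ?_⟩
  · rw [Fin.mk_lt_mk]; omega
  · rw [Fin.mk_lt_mk]; omega
  · rw [Fin.mk_lt_mk]; omega
  · rw [Ne, Fin.mk.injEq]; omega
  · simp only [ha1, hb1]; omega
  · simp only [Finset.mem_insert, Finset.mem_singleton, Fin.ext_iff]; omega
  · simp only [Finset.mem_insert, Finset.mem_singleton, Fin.ext_iff]; omega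

theorem isLHypertree_orderedExtension (m : ℕ) :
    IsLHypertree 4 2 (orderedExtension (2 ^ (m + 3) - 1)) := by
  have hE : ∀ e ∈ orderedExtension (2 ^ (m + 3) - 1), ∀ f ∈ orderedExtension (2 ^ (m + 3) - 1),
      e ≠ f → 3 ≤ (e ∩ f).card → e ∩ f = lowerTriple e :=
    fun e he f hf => inter_eq_lowerTriple he hf
  refine ⟨⟨fun e he => card_eq_four_of_mem_orderedExtension he, ?_,
    semicycleFree_of_kernel (fun e he => card_lowerTriple he) hE⟩,
    chainsLenLE_two_of_kernel (fun e he => card_lowerTriple he) hE⟩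
  intro u _ v _ huv
  rcases lt_or_gt_of_ne huv with h | h
  · obtain ⟨e, he, hu, hv⟩ := exists_mem_orderedExtension m h
    exact chain_of_edge he (card_eq_four_of_mem_orderedExtension he) hu hv
  · obtain ⟨e, he, hv, hu⟩ := exists_mem_orderedExtension m h
    exact chain_of_edge he (card_eq_four_of_mem_orderedExtension he) hu hv

theorem card_orderedExtension_div (m : ℕ) :
    ((orderedExtension (2 ^ (m + 3) - 1)).card : ℝ) / ((2 ^ (m + 3) - 1).choose 3 : ℝ) =
      2 / 7 * (1 - 1 / ((2 : ℝ) ^ (m + 3) - 3)) := by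
  have h8 : (8 : ℝ) ≤ 2 ^ (m + 3) := by
    have : (1 : ℝ) ≤ 2 ^ m := one_le_pow₀ (by norm_num)
    rw [pow_add]; linarith
  have hcard := card_orderedExtension (m + 3)
  have hch : ((2 ^ (m + 3) - 1).choose 3 : ℝ) =
      ((2 : ℝ) ^ (m + 3) - 1) * (2 ^ (m + 3) - 2) * (2 ^ (m + 3) - 3) / 6 := by
    rw [Nat.cast_choose_eq_descPochhammer_div]
    simp [descPochhammer_succ_right, Nat.factorial]
    ring
  have hcard' : ((orderedExtension (2 ^ (m + 3) - 1)).card : ℝ) =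
      ((2 : ℝ) ^ (m + 3) - 1) * (2 ^ (m + 3) - 2) * (2 ^ (m + 3) - 4) / 21 := by linarith
  rw [hcard', hch]
  generalize (2 : ℝ) ^ (m + 3) = M at h8
  have h1 : M - 1 ≠ 0 := by linarith
  have h2 : M - 2 ≠ 0 := by linarith
  have h3 : M - 3 ≠ 0 := by linarith
  field_simp
  ring

/-- a sequence of 4-uniform 2-hypertrees with edge number
asymptotically `(2/7)·C(n, 3)`. -/
theorem stmt11 : ∃ n e : ℕ → ℕ, StrictMono n ∧
    (∀ m, ∃ E : Finset (Finset (Fin (n m))), IsLHypertree 4 2 E ∧ E.card = e m) ∧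
    Filter.Tendsto (fun m => (e m : ℝ) / ((n m).choose 3 : ℝ))
      Filter.atTop (nhds (2 / 7)) := by
  refine ⟨fun m => 2 ^ (m + 3) - 1, fun m => (orderedExtension (2 ^ (m + 3) - 1)).card, ?_,
    fun m => ⟨_, isLHypertree_orderedExtension m, rfl⟩, ?_⟩
  · refine strictMono_nat_of_lt_succ fun m => ?_
    have hp : 2 ^ (m + 3) < 2 ^ (m + 1 + 3) := Nat.pow_lt_pow_right (by norm_num) (by omega)
    have hp' : 0 < 2 ^ (m + 3) := by positivity
    omega
  · simp only [card_orderedExtension_div]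
    have h : Filter.Tendsto (fun m : ℕ => (2 : ℝ) ^ (m + 3) - 3) Filter.atTop Filter.atTop :=
      Filter.tendsto_atTop_add_const_right _ _
        ((Filter.tendsto_add_atTop_iff_nat 3).2
          (tendsto_pow_atTop_atTop_of_one_lt (by norm_num)))
    have h' := (h.inv_tendsto_atTop.const_sub 1).const_mul (2 / 7 : ℝ)
    simpa [Pi.inv_apply, one_div] using h'
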